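/- Let P be an augmented program and M ⊆ σ_P a set of atoms. Then M is an answer set of P if and only if the theory P ∪ ¬M̃ ∪ ¬¬M is consistent in intuitionistic logic and P ∪ ¬M̃ ∪ ¬¬M ⊢_I a for every atom a ∈ M (i.e., P ∪ ¬M̃ ∪ ¬¬M ⊩_I M). -/

import Mathlib

namespace ASP

/-- Propositional formulas over atoms `α`, built with ∧, ∨, ← and ⊥.
`impl A B` denotes the formula `B ← A` (i.e. `A → B`). -/
inductive PropForm (α : Type) : Type
  | var : α → PropForm α
  | fals : PropForm α
  | conj : PropForm α → PropForm α → PropForm α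
  | disj : PropForm α → PropForm α → PropForm α
  | impl : PropForm α → PropForm α → PropForm α
  deriving DecidableEq

namespace PropForm

variable {α : Type}

/-- `¬F` abbreviates `⊥ ← F`. -/
def neg (A : PropForm α) : PropForm α := impl A fals

/-- `⊤` abbreviates `⊥ ← ⊥`. -/
def top : PropForm α := impl fals fals

/-- The set of atoms occurring in a formula. -/
def atoms : PropForm α → Set α
  | var a => {a}
  | fals => ∅
  | conj A B => atoms A ∪ atoms B
  | disj A B => atoms A ∪ atoms B
  | impl A B => atoms A ∪ atoms B

end PropForm

open PropForm

/-- Hilbert-style derivability for intuitionistic propositional logic,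
with an extra set `Ax` of additional axioms. -/
inductive Deriv {α : Type} (Ax : Set (PropForm α)) : PropForm α → Prop
  | ax {A} : A ∈ Ax → Deriv Ax A
  | k (A B) : Deriv Ax (impl A (impl B A))
  | s (A B C) : Deriv Ax (impl (impl A (impl B C)) (impl (impl A B) (impl A C)))
  | conjIntro (A B) : Deriv Ax (impl A (impl B (conj A B)))
  | conjElimL (A B) : Deriv Ax (impl (conj A B) A)
  | conjElimR (A B) : Deriv Ax (impl (conj A B) B)
  | disjIntroL (A B) : Deriv Ax (impl A (disj A B))
  | disjIntroR (A B) : Deriv Ax (impl B (disj A B))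
  | disjElim (A B C) : Deriv Ax (impl (impl A C) (impl (impl B C) (impl (disj A B) C)))
  | falsElim (A) : Deriv Ax (impl fals A)
  | mp {A B} : Deriv Ax (impl A B) → Deriv Ax A → Deriv Ax B

/-- `F` is a theorem of intuitionistic propositional logic. -/
def IThm {α : Type} (F : PropForm α) : Prop := Deriv ∅ F

/-- `F` is a theorem of classical propositional logic
(intuitionistic logic plus double-negation elimination). -/
def CThm {α : Type} (F : PropForm α) : Prop :=
  Deriv {F | ∃ A, F = impl (neg (neg A)) A} F

/-- Conjunction of a finite list of formulas (empty conjunction is ⊤). -/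
def bigConj {α : Type} : List (PropForm α) → PropForm α
  | [] => top
  | [A] => A
  | A :: L => conj A (bigConj L)

/-- Disjunction of a finite list of formulas (empty disjunction is ⊥). -/
def bigDisj {α : Type} : List (PropForm α) → PropForm α
  | [] => fals
  | [A] => A
  | A :: L => disj A (bigDisj L)

/-- `T ⊢_X F`: the formula `F ← (F₁ ∧ ... ∧ Fₙ)` is a theorem of the logic
whose theorems are `Thm`, for some `F₁, ..., Fₙ ∈ T`. -/
def ProvesFrom {α : Type} (Thm : PropForm α → Prop) (T : Set (PropForm α))
    (F : PropForm α) : Prop :=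
  ∃ L : List (PropForm α), (∀ G ∈ L, G ∈ T) ∧ Thm (impl (bigConj L) F)

/-- `T ⊢_I F`. -/
def IProves {α : Type} (T : Set (PropForm α)) (F : PropForm α) : Prop :=
  ProvesFrom IThm T F

/-- `T ⊢_C F`. -/
def CProves {α : Type} (T : Set (PropForm α)) (F : PropForm α) : Prop :=
  ProvesFrom CThm T F

/-- `T` is consistent in intuitionistic logic. -/
def IConsistent {α : Type} (T : Set (PropForm α)) : Prop := ¬ IProves T fals

/-- `T ⊩_I M`: `T` is consistent and proves (intuitionistically) every atom of `M`. -/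
def IProvesAll {α : Type} (T : Set (PropForm α)) (M : Set α) : Prop :=
  IConsistent T ∧ ∀ a ∈ M, IProves T (var a)

/-- `T ≡_I U`: the two theories prove each other's formulas intuitionistically. -/
def IEquivTh {α : Type} (T U : Set (PropForm α)) : Prop :=
  (∀ F ∈ U, IProves T F) ∧ (∀ F ∈ T, IProves U F)

/-- The signature (set of occurring atoms) of a theory. -/
def sigTh {α : Type} (T : Set (PropForm α)) : Set α := ⋃ F ∈ T, F.atoms

/-- `T` is (literal) complete: for every atom `a` of its signature,
`T ⊢_I a` or `T ⊢_I ¬a`. -/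
def IComplete {α : Type} (T : Set (PropForm α)) : Prop :=
  ∀ a ∈ sigTh T, IProves T (var a) ∨ IProves T (neg (var a))

/-- `{¬a : a ∈ S}`. -/
def negSet {α : Type} (S : Set α) : Set (PropForm α) := (fun a => neg (var a)) '' S

/-- `{¬¬a : a ∈ S}`. -/
def negnegSet {α : Type} (S : Set α) : Set (PropForm α) :=
  (fun a => neg (neg (var a))) '' S

/-- Classical two-valued satisfaction, identifying an interpretation with the
set of atoms it makes true. -/
def sat2 {α : Type} (X : Set α) : PropForm α → Prop
  | .var a => a ∈ X
  | .fals => False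
  | .conj A B => sat2 X A ∧ sat2 X B
  | .disj A B => sat2 X A ∨ sat2 X B
  | .impl A B => sat2 X A → sat2 X B

/-- `X` is a classical model of the theory `T`. -/
def isModel2 {α : Type} (X : Set α) (T : Set (PropForm α)) : Prop := ∀ F ∈ T, sat2 X F

/-- `M` is a minimal (under ⊆) classical model of `T`. -/
def isMinModel {α : Type} (T : Set (PropForm α)) (M : Set α) : Prop :=
  isModel2 M T ∧ ∀ N ⊆ M, isModel2 N T → N = M

/-- Evaluation in the 3-valued Gödel logic G3. -/
def g3 {α : Type} (I : α → Fin 3) : PropForm α → Fin 3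
  | .var a => I a
  | .fals => 0
  | .conj A B => min (g3 I A) (g3 I B)
  | .disj A B => max (g3 I A) (g3 I B)
  | .impl A B => if g3 I A ≤ g3 I B then 2 else g3 I B

/-- Nested formulas: built from atoms, ⊤ and ⊥ using ∧, ∨ and ¬. -/
inductive NF (α : Type) : Type
  | var : α → NF α
  | top : NF α
  | bot : NF α
  | conj : NF α → NF α → NF α
  | disj : NF α → NF α → NF α
  | neg : NF α → NF α
  deriving DecidableEq

namespace NF

variable {α : Type}

/-- Reading a nested formula as a propositional formula
(`⊤ = ⊥ ← ⊥` and `¬F = ⊥ ← F`). -/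
def toProp : NF α → PropForm α
  | var a => .var a
  | top => PropForm.top
  | bot => .fals
  | conj A B => .conj (toProp A) (toProp B)
  | disj A B => .disj (toProp A) (toProp B)
  | neg A => PropForm.neg (toProp A)

/-- Atoms occurring in a nested formula. -/
def atoms : NF α → Set α
  | var a => {a}
  | top => ∅
  | bot => ∅
  | conj A B => atoms A ∪ atoms B
  | disj A B => atoms A ∪ atoms B
  | neg A => atoms A

/-- Satisfaction of a (basic, negation-free) nested formula by a set of atoms. -/
def satB (X : Set α) : NF α → Prop
  | var a => a ∈ X
  | top => True
  | bot => False
  | conj A B => satB X A ∧ satB X B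
  | disj A B => satB X A ∨ satB X B
  | neg A => ¬ satB X A

open scoped Classical in
/-- The reduct `F^X`: each maximal subformula `¬G` is replaced by ⊥ if
`X ⊨ G^X` and by ⊤ otherwise. -/
noncomputable def reduct (X : Set α) : NF α → NF α
  | var a => var a
  | top => top
  | bot => bot
  | conj A B => conj (reduct X A) (reduct X B)
  | disj A B => disj (reduct X A) (reduct X B)
  | neg A => if satB X (reduct X A) then bot else top

end NF

/-- An augmented clause `H ← B` is a pair `(H, B)` of nested formulas. -/
abbrev AugClause (α : Type) := NF α × NF α

/-- The propositional formula `H ← B` of an augmented clause. -/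
def clauseToProp {α : Type} (c : AugClause α) : PropForm α :=
  .impl c.2.toProp c.1.toProp

/-- The theory of an augmented program. -/
def progTh {α : Type} (P : List (AugClause α)) : Set (PropForm α) :=
  {F | ∃ c ∈ P, clauseToProp c = F}

/-- The signature of an augmented program. -/
def progSig {α : Type} (P : List (AugClause α)) : Set α :=
  {a | ∃ c ∈ P, a ∈ c.1.atoms ∪ c.2.atoms}

/-- `X` is closed under the (basic) program `P`: for each clause `H ← B`,
`X ⊨ H` whenever `X ⊨ B`. -/
def closedUnder {α : Type} (X : Set α) (P : List (AugClause α)) : Prop :=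
  ∀ c ∈ P, NF.satB X c.2 → NF.satB X c.1

/-- The reduct `P^X` of an augmented program. -/
noncomputable def progReduct {α : Type} (X : Set α) (P : List (AugClause α)) :
    List (AugClause α) :=
  P.map fun c => (c.1.reduct X, c.2.reduct X)

/-- `M` is an answer set of `P`: `M` is minimal (under ⊆) among the sets of
atoms closed under the reduct `P^M`. -/
def isAnswerSet {α : Type} (P : List (AugClause α)) (M : Set α) : Prop :=
  closedUnder M (progReduct M P) ∧ ∀ N ⊆ M, closedUnder N (progReduct M P) → N = M

/-- `M` is a min-answer set of `P`: both an answer set and a minimal model. -/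
def isMinAnswerSet {α : Type} (P : List (AugClause α)) (M : Set α) : Prop :=
  isAnswerSet P M ∧ isMinModel (progTh P) M

/-- A G3 interpretation models an augmented program. -/
def g3ModelsProg {α : Type} (I : α → Fin 3) (P : List (AugClause α)) : Prop :=
  ∀ c ∈ P, g3 I (clauseToProp c) = 2

/-- A free clause: a list of head literals and a list of body literals,
a literal being an atom `(a, true)` or a negated atom `(a, false)`.
It denotes `h₁ ∨ ... ∨ hₙ ← b₁ ∧ ... ∧ bₘ` (empty head = ⊥, empty body = ⊤). -/
structure FClause (α : Type) where
  head : List (α × Bool)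
  body : List (α × Bool)
  deriving DecidableEq

/-- The propositional formula of a literal. -/
def litToProp {α : Type} : α × Bool → PropForm α
  | (a, true) => .var a
  | (a, false) => PropForm.neg (.var a)

/-- The nested formula of a literal. -/
def litToNF {α : Type} : α × Bool → NF α
  | (a, true) => .var a
  | (a, false) => .neg (.var a)

/-- Disjunction of a list of nested formulas (empty = ⊥). -/
def bigDisjNF {α : Type} : List (NF α) → NF α
  | [] => .bot
  | [A] => A
  | A :: L => .disj A (bigDisjNF L)

/-- Conjunction of a list of nested formulas (empty = ⊤). -/
def bigConjNF {α : Type} : List (NF α) → NF α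
  | [] => .top
  | [A] => A
  | A :: L => .conj A (bigConjNF L)

namespace FClause

variable {α : Type}

/-- The propositional formula of a free clause. -/
def toProp (c : FClause α) : PropForm α :=
  .impl (bigConj (c.body.map litToProp)) (bigDisj (c.head.map litToProp))

/-- A free clause as an augmented clause. -/
def toAug (c : FClause α) : AugClause α :=
  (bigDisjNF (c.head.map litToNF), bigConjNF (c.body.map litToNF))

/-- The atoms of a free clause. -/
def atomsF (c : FClause α) : Set α :=
  {a | (∃ b, (a, b) ∈ c.head) ∨ (∃ b, (a, b) ∈ c.body)}

/-- A general clause: all head literals are positive atoms. -/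
def isGeneral (c : FClause α) : Prop := ∀ l ∈ c.head, l.2 = true

/-- A disjunctive clause: a general clause with nonempty head. -/
def isDisjunctive (c : FClause α) : Prop := c.isGeneral ∧ c.head ≠ []

/-- A constraint: a clause with empty head (head ⊥). -/
def isConstraint (c : FClause α) : Prop := c.head = []

end FClause

/-- The theory of a free program. -/
def fTh {α : Type} (P : List (FClause α)) : Set (PropForm α) :=
  {F | ∃ c ∈ P, c.toProp = F}

/-- The signature of a free program. -/
def fSig {α : Type} (P : List (FClause α)) : Set α :=
  {a | ∃ c ∈ P, a ∈ c.atomsF}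

/-- `GenDisj(P)`: each constraint `⊥ ← B` is replaced by `p ← B ∧ ¬p`,
where `p` is a new reserved atom. -/
def genDisj {α : Type} [DecidableEq α] (P : List (FClause α)) (p : α) :
    List (FClause α) :=
  P.map fun c =>
    if c.head = [] then ⟨[(p, true)], c.body ++ [(p, false)]⟩ else c

/-- The atoms `a` such that `¬a` occurs in the head of some clause of `P`
(the set `S` of the FreeGen transformation), as a list. -/
def headNegs {α : Type} (P : List (FClause α)) : List α :=
  P.flatMap fun c => c.head.filterMap fun l => if l.2 = false then some l.1 else none

open scoped Classical in
/-- Replace the occurrence of `¬a` (for `a ∈ S`) by the positive atom `φ a`. -/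
noncomputable def substLit {α : Type} (S : Set α) (φ : α → α) (l : α × Bool) :
    α × Bool :=
  if l.2 = false ∧ l.1 ∈ S then (φ l.1, true) else l

/-- Replace every occurrence of `¬a` (for `a ∈ S`) by `φ a` in a clause. -/
noncomputable def FClause.subst {α : Type} (S : Set α) (φ : α → α) (c : FClause α) :
    FClause α :=
  ⟨c.head.map (substLit S φ), c.body.map (substLit S φ)⟩

/-- `Δ_S = ⋃_{a ∈ S} {φ(a) ← ¬a, ⊥ ← a ∧ φ(a)}`. -/
def deltaClauses {α : Type} (L : List α) (φ : α → α) : List (FClause α) :=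
  L.flatMap fun a => [⟨[(φ a, true)], [(a, false)]⟩, ⟨[], [(a, true), (φ a, true)]⟩]

/-- `FreeGen(P) = P' ∪ Δ_S`. -/
noncomputable def freeGen {α : Type} (P : List (FClause α)) (φ : α → α) :
    List (FClause α) :=
  P.map (FClause.subst {a | a ∈ headNegs P} φ) ++ deltaClauses (headNegs P) φ

open scoped Classical in
/-- The second reduction `redu2(P; ¬¬M)`: clauses whose body contains a literal
`¬a` with `a ∈ M` are deleted; in constraints, positive body literals `a ∈ M`
are deleted. -/
noncomputable def redu2 {α : Type} [DecidableEq α] (P : List (FClause α))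
    (M : Set α) : List (FClause α) :=
  (P.filter fun c => decide (¬ ∃ l ∈ c.body, l.2 = false ∧ l.1 ∈ M)).map
    fun c =>
      if c.head = [] then
        ⟨[], c.body.filter fun l => decide (¬ (l.2 = true ∧ l.1 ∈ M))⟩
      else c

/-- `P₂` is a conservative extension of `P₁`: `M₁` is an answer set of `P₁`
iff `M₂` is an answer set of `P₂`, where `M₁ = M₂ ∩ σ_{P₁}`. -/
def consExt {α : Type} (P1 P2 : List (AugClause α)) : Prop :=
  (∀ M2 : Set α, isAnswerSet P2 M2 → isAnswerSet P1 (M2 ∩ progSig P1)) ∧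
  (∀ M1 : Set α, isAnswerSet P1 M1 →
    ∃ M2 : Set α, isAnswerSet P2 M2 ∧ M1 = M2 ∩ progSig P1)

/-- `P₂` is a strong conservative extension of the user program `P₁` (relative
to the user signature `U`): for every user program `P`, `P₂ ∪ P` is a
conservative extension of `P₁ ∪ P`. -/
def strongConsExt {α : Type} (P1 P2 : List (AugClause α)) (U : Set α) : Prop :=
  ∀ P : List (AugClause α), progSig P ⊆ U → consExt (P1 ++ P) (P2 ++ P)

mutual
  /-- Negation normal form: push negations inward (no pending negation). -/
  def nnf0 {α : Type} : NF α → NF α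
    | .var a => .var a
    | .top => .top
    | .bot => .bot
    | .conj A B => .conj (nnf0 A) (nnf0 B)
    | .disj A B => .disj (nnf0 A) (nnf0 B)
    | .neg A => nnf1 A
  /-- Negation normal form under one pending negation. -/
  def nnf1 {α : Type} : NF α → NF α
    | .var a => .neg (.var a)
    | .top => .bot
    | .bot => .top
    | .conj A B => .disj (nnf1 A) (nnf1 B)
    | .disj A B => .conj (nnf1 A) (nnf1 B)
    | .neg A => nnf2 A
  /-- Negation normal form under two pending negations. -/
  def nnf2 {α : Type} : NF α → NF α
    | .var a => .neg (.neg (.var a))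
    | .top => .top
    | .bot => .bot
    | .conj A B => .conj (nnf2 A) (nnf2 B)
    | .disj A B => .disj (nnf2 A) (nnf2 B)
    | .neg A => nnf1 A
end

/-- Conjunctive normal form (list of disjunction-lists of leaves). -/
def cnfNF {α : Type} : NF α → List (List (NF α))
  | .conj A B => cnfNF A ++ cnfNF B
  | .disj A B => (cnfNF A).flatMap fun c => (cnfNF B).map fun d => c ++ d
  | F => [[F]]

/-- Disjunctive normal form (list of conjunction-lists of leaves). -/
def dnfNF {α : Type} : NF α → List (List (NF α))
  | .disj A B => dnfNF A ++ dnfNF B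
  | .conj A B => (dnfNF A).flatMap fun c => (dnfNF B).map fun d => c ++ d
  | F => [[F]]

/-- Read a leaf as a literal (if it is one). -/
def leafLit {α : Type} : NF α → Option (α × Bool)
  | .var a => some (a, true)
  | .neg (.var a) => some (a, false)
  | _ => none

/-- Read a leaf `¬¬a` as the literal `¬a` to be moved to the other side. -/
def dnegLit {α : Type} : NF α → Option (α × Bool)
  | .neg (.neg (.var a)) => some (a, false)
  | _ => none

/-- Build a free clause from a head disjunct-list and a body conjunct-list:
doubly negated atoms `¬¬a` in the head become `¬a` in the body and vice versa;
trivial clauses (⊤ in the head or ⊥ in the body) are removed. -/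
def procClause {α : Type} [DecidableEq α] (hd bd : List (NF α)) :
    Option (FClause α) :=
  if NF.top ∈ hd ∨ NF.bot ∈ bd then none
  else some ⟨hd.filterMap leafLit ++ bd.filterMap dnegLit,
             bd.filterMap leafLit ++ hd.filterMap dnegLit⟩

/-- `AugFree(P)`: the free program obtained from the augmented program `P` by
pushing negations inward, taking CNF of heads and DNF of bodies, splitting
conjunctions in heads and disjunctions in bodies into separate clauses, and
eliminating doubly negated atoms. -/
def augFree {α : Type} [DecidableEq α] (P : List (AugClause α)) :
    List (FClause α) :=
  P.flatMap fun c =>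
    (cnfNF (nnf0 c.1)).flatMap fun hd =>
      (dnfNF (nnf0 c.2)).filterMap fun bd => procClause hd bd

/-- Positive formulas: no negation (in particular no ⊥) occurs. -/
def IsPositive {α : Type} : PropForm α → Prop
  | .var _ => True
  | .fals => False
  | .conj A B => IsPositive A ∧ IsPositive B
  | .disj A B => IsPositive A ∧ IsPositive B
  | .impl A B => IsPositive A ∧ IsPositive B

/-- The set 𝐍 of two-negated formulas. -/
inductive IsTwoNeg {α : Type} : PropForm α → Prop
  | atom (a : α) : IsTwoNeg (neg (neg (var a)))
  | dneg {A} : IsTwoNeg A → IsTwoNeg (neg (neg A))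
  | conj {A B} : IsTwoNeg A → IsTwoNeg B → IsTwoNeg (PropForm.conj A B)
  | disjL {A} (B) : IsTwoNeg A → IsTwoNeg (PropForm.disj A B)
  | disjR {A} (B) : IsTwoNeg A → IsTwoNeg (PropForm.disj B A)
  | himp {A} (B) : IsTwoNeg A → IsTwoNeg (PropForm.impl B A)

namespace Deriv

variable {α : Type} {T U : Set (PropForm α)} {A B C : PropForm α}

theorem mono (h : T ⊆ U) (hA : Deriv T A) : Deriv U A := by
  induction hA with
  | ax hA => exact .ax (h hA)
  | k A B => exact .k A B
  | s A B C => exact .s A B C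
  | conjIntro A B => exact .conjIntro A B
  | conjElimL A B => exact .conjElimL A B
  | conjElimR A B => exact .conjElimR A B
  | disjIntroL A B => exact .disjIntroL A B
  | disjIntroR A B => exact .disjIntroR A B
  | disjElim A B C => exact .disjElim A B C
  | falsElim A => exact .falsElim A
  | mp _ _ ih₁ ih₂ => exact .mp ih₁ ih₂

theorem weaken (A : PropForm α) (hB : Deriv T B) : Deriv T (impl A B) :=
  .mp (.k B A) hB

theorem impl_self (T : Set (PropForm α)) (A : PropForm α) : Deriv T (impl A A) :=
  .mp (.mp (.s A (impl A A) A) (.k A (impl A A))) (.k A A)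

/-- The deduction theorem. -/
theorem deduction (h : Deriv (insert A T) B) : Deriv T (impl A B) := by
  induction h with
  | ax hB =>
    rcases hB with rfl | hB
    · exact impl_self T _
    · exact weaken A (.ax hB)
  | k B C => exact weaken A (.k B C)
  | s B C D => exact weaken A (.s B C D)
  | conjIntro B C => exact weaken A (.conjIntro B C)
  | conjElimL B C => exact weaken A (.conjElimL B C)
  | conjElimR B C => exact weaken A (.conjElimR B C)
  | disjIntroL B C => exact weaken A (.disjIntroL B C)
  | disjIntroR B C => exact weaken A (.disjIntroR B C)
  | disjElim B C D => exact weaken A (.disjElim B C D)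
  | falsElim B => exact weaken A (.falsElim B)
  | mp _ _ ih₁ ih₂ => exact .mp (.mp (.s _ _ _) ih₁) ih₂

theorem impl_trans (h₁ : Deriv T (impl A B)) (h₂ : Deriv T (impl B C)) :
    Deriv T (impl A C) :=
  .mp (.mp (.s A B C) (weaken A h₂)) h₁

theorem conj_iff : Deriv T (conj A B) ↔ Deriv T A ∧ Deriv T B :=
  ⟨fun h => ⟨.mp (.conjElimL A B) h, .mp (.conjElimR A B) h⟩,
    fun h => .mp (.mp (.conjIntro A B) h.1) h.2⟩

theorem disj_elim (h : Deriv T (disj A B)) (hA : Deriv T (impl A C))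
    (hB : Deriv T (impl B C)) : Deriv T C :=
  .mp (.mp (.mp (.disjElim A B C) hA) hB) h

theorem bigConj_iff {L : List (PropForm α)} :
    Deriv T (bigConj L) ↔ ∀ G ∈ L, Deriv T G := by
  induction L with
  | nil => simpa [bigConj] using show Deriv T top from impl_self T fals
  | cons A L ih =>
    cases L with
    | nil => simp [bigConj]
    | cons B L =>
      rw [bigConj, conj_iff, ih]
      · simp
      · simp

/-- A derivation uses only one member of a nonempty chain of theories. -/
theorem exists_of_sUnion {c : Set (Set (PropForm α))} (hc : IsChain (· ⊆ ·) c)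
    (hne : c.Nonempty) (h : Deriv (⋃₀ c) A) : ∃ S ∈ c, Deriv S A := by
  obtain ⟨S₀, hS₀⟩ := hne
  induction h with
  | ax hA =>
    obtain ⟨S, hS, hA⟩ := hA
    exact ⟨S, hS, .ax hA⟩
  | k A B => exact ⟨S₀, hS₀, .k A B⟩
  | s A B C => exact ⟨S₀, hS₀, .s A B C⟩
  | conjIntro A B => exact ⟨S₀, hS₀, .conjIntro A B⟩
  | conjElimL A B => exact ⟨S₀, hS₀, .conjElimL A B⟩
  | conjElimR A B => exact ⟨S₀, hS₀, .conjElimR A B⟩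
  | disjIntroL A B => exact ⟨S₀, hS₀, .disjIntroL A B⟩
  | disjIntroR A B => exact ⟨S₀, hS₀, .disjIntroR A B⟩
  | disjElim A B C => exact ⟨S₀, hS₀, .disjElim A B C⟩
  | falsElim A => exact ⟨S₀, hS₀, .falsElim A⟩
  | mp _ _ ih₁ ih₂ =>
    obtain ⟨S₁, hS₁, h₁⟩ := ih₁
    obtain ⟨S₂, hS₂, h₂⟩ := ih₂
    rcases hc.total hS₁ hS₂ with h | h
    · exact ⟨S₂, hS₂, .mp (h₁.mono h) h₂⟩
    · exact ⟨S₁, hS₁, .mp h₁ (h₂.mono h)⟩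

/-- Lindenbaum's lemma: a theory not deriving `A` extends to a prime theory not deriving `A`. -/
theorem exists_prime_extension (h : ¬ Deriv T A) :
    ∃ S, T ⊆ S ∧ ¬ Deriv S A ∧
      ∀ B C, Deriv S (disj B C) → Deriv S B ∨ Deriv S C := by
  obtain ⟨S, hTS, hS⟩ := zorn_subset_nonempty {S | ¬ Deriv S A}
    (fun c hc hchain hne => ⟨⋃₀ c, fun hA => by
      obtain ⟨S, hSc, hSA⟩ := exists_of_sUnion hchain hne hA
      exact hc hSc hSA, fun S hSc => Set.subset_sUnion_of_mem hSc⟩) T h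
  have key : ∀ B, ¬ Deriv S B → Deriv S (impl B A) := fun B hB => by
    refine deduction (by_contra fun hA => hB (.ax ?_))
    exact hS.2 hA (Set.subset_insert B S) (Set.mem_insert B S)
  refine ⟨S, hTS, hS.1, fun B C hBC => ?_⟩
  by_contra! hcon
  exact hS.1 (disj_elim hBC (key B hcon.1) (key C hcon.2))

end Deriv

theorem iProves_iff_deriv {α : Type} {T : Set (PropForm α)} {F : PropForm α} :
    IProves T F ↔ Deriv T F := by
  constructor
  · rintro ⟨L, hL, h⟩
    exact .mp (h.mono (Set.empty_subset T)) (Deriv.bigConj_iff.2 fun G hG => .ax (hL G hG))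
  · intro h
    have base : ∀ {G : PropForm α}, IThm G → IProves T G :=
      fun hG => ⟨[], by simp, Deriv.weaken _ hG⟩
    induction h with
    | @ax A hA => exact ⟨[A], by simpa using hA, Deriv.impl_self ∅ A⟩
    | k A B => exact base (.k A B)
    | s A B C => exact base (.s A B C)
    | conjIntro A B => exact base (.conjIntro A B)
    | conjElimL A B => exact base (.conjElimL A B)
    | conjElimR A B => exact base (.conjElimR A B)
    | disjIntroL A B => exact base (.disjIntroL A B)
    | disjIntroR A B => exact base (.disjIntroR A B)
    | disjElim A B C => exact base (.disjElim A B C)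
    | falsElim A => exact base (.falsElim A)
    | mp _ _ ih₁ ih₂ =>
      obtain ⟨L₁, hL₁, h₁⟩ := ih₁
      obtain ⟨L₂, hL₂, h₂⟩ := ih₂
      refine ⟨L₁ ++ L₂, fun G hG => (List.mem_append.1 hG).elim (hL₁ G) (hL₂ G), ?_⟩
      have hall := Deriv.bigConj_iff.1
        (Deriv.ax (Set.mem_insert (bigConj (L₁ ++ L₂)) (∅ : Set (PropForm α))))
      refine Deriv.deduction (.mp (.mp (h₁.mono (Set.empty_subset _)) ?_)
        (.mp (h₂.mono (Set.empty_subset _)) ?_))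
      · exact Deriv.bigConj_iff.2 fun G hG => hall G (List.mem_append_left L₂ hG)
      · exact Deriv.bigConj_iff.2 fun G hG => hall G (List.mem_append_right L₁ hG)

/-- Satisfaction at the lower world of the here-and-there model `(N, M)`. -/
def satHT {α : Type} (N M : Set α) : PropForm α → Prop
  | .var a => a ∈ N
  | .fals => False
  | .conj A B => satHT N M A ∧ satHT N M B
  | .disj A B => satHT N M A ∨ satHT N M B
  | .impl A B => (satHT N M A → satHT N M B) ∧ (sat2 M A → sat2 M B)

section Semantics

variable {α : Type} {N M : Set α}

theorem sat2_of_satHT (hNM : N ⊆ M) {F : PropForm α} (h : satHT N M F) : sat2 M F := by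
  induction F with
  | var a => exact hNM h
  | fals => exact h
  | conj A B ihA ihB => exact ⟨ihA h.1, ihB h.2⟩
  | disj A B ihA ihB => exact h.imp ihA ihB
  | impl A B => exact h.2

/-- Intuitionistic derivability is sound for here-and-there models. -/
theorem Deriv.satHT {T : Set (PropForm α)} (hNM : N ⊆ M) (hT : ∀ G ∈ T, ASP.satHT N M G)
    {F : PropForm α} (h : Deriv T F) : ASP.satHT N M F := by
  have up : ∀ G : PropForm α, ASP.satHT N M G → sat2 M G := fun _ => sat2_of_satHT hNM
  induction h with
  | ax hA => exact hT _ hA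
  | k A B | conjIntro A B | conjElimL A B | conjElimR A B | disjIntroL A B | disjIntroR A B =>
    have := up A
    have := up B
    simp only [ASP.satHT, sat2]
    tauto
  | s A B C | disjElim A B C =>
    have := up A
    have := up B
    have := up C
    simp only [ASP.satHT, sat2]
    tauto
  | falsElim A => exact ⟨False.elim, False.elim⟩
  | mp _ _ ih₁ ih₂ => exact ih₁.1 ih₂

theorem NF.satB_reduct_self (F : NF α) : (F.reduct M).satB M ↔ sat2 M F.toProp := by
  induction F with
  | var a => rfl
  | top => simp [NF.reduct, NF.satB, NF.toProp, PropForm.top, sat2]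
  | bot => rfl
  | conj A B ihA ihB => exact and_congr ihA ihB
  | disj A B ihA ihB => exact or_congr ihA ihB
  | neg A ih =>
    by_cases h : sat2 M A.toProp <;>
      simp [NF.reduct, NF.satB, NF.toProp, PropForm.neg, sat2, ih, h]

theorem NF.satB_reduct (hNM : N ⊆ M) (F : NF α) :
    (F.reduct M).satB N ↔ satHT N M F.toProp := by
  induction F with
  | var a => rfl
  | top => simp [NF.reduct, NF.satB, NF.toProp, PropForm.top, satHT]
  | bot => rfl
  | conj A B ihA ihB => exact and_congr ihA ihB
  | disj A B ihA ihB => exact or_congr ihA ihB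
  | neg A ih =>
    have up : satHT N M A.toProp → sat2 M A.toProp := sat2_of_satHT hNM
    by_cases h : sat2 M A.toProp
    · simp [NF.reduct, NF.satB, NF.toProp, PropForm.neg, satHT, sat2, satB_reduct_self, h]
    · have h' : ¬ satHT N M A.toProp := fun hA => h (up hA)
      simp [NF.reduct, NF.satB, NF.toProp, PropForm.neg, satHT, sat2, satB_reduct_self, h, h']

theorem closedUnder_progReduct {X : Set α} {P : List (AugClause α)} :
    closedUnder X (progReduct M P) ↔
      ∀ c ∈ P, (c.2.reduct M).satB X → (c.1.reduct M).satB X := by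
  simp only [closedUnder, progReduct, List.forall_mem_map]

/-- A theory deciding every atom of `F` according to `M`, up to double negation, decides `F`
in the same way. -/
theorem NF.deriv_of_decides {T : Set (PropForm α)} {F : NF α}
    (hpos : ∀ a ∈ F.atoms, a ∈ M → Deriv T (PropForm.neg (PropForm.neg (.var a))))
    (hneg : ∀ a ∈ F.atoms, a ∉ M → Deriv T (PropForm.neg (.var a))) :
    (sat2 M F.toProp → Deriv T (PropForm.neg (PropForm.neg F.toProp))) ∧
      (¬ sat2 M F.toProp → Deriv T (PropForm.neg F.toProp)) := by
  have dni : ∀ {G : PropForm α}, Deriv T G → Deriv T (PropForm.neg (PropForm.neg G)) :=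
    fun hG => Deriv.deduction <|
      .mp (.ax (Set.mem_insert _ _)) (hG.mono (Set.subset_insert _ _))
  have dnimap : ∀ {G H : PropForm α}, Deriv T (impl G H) →
      Deriv T (PropForm.neg (PropForm.neg G)) → Deriv T (PropForm.neg (PropForm.neg H)) :=
    fun {G H} hGH hG => Deriv.deduction <| .mp (hG.mono (Set.subset_insert _ _)) <|
      Deriv.impl_trans (hGH.mono (Set.subset_insert _ _)) (.ax (Set.mem_insert _ _))
  induction F with
  | var a => exact ⟨hpos a rfl, hneg a rfl⟩
  | top =>
    exact ⟨fun _ => dni (Deriv.impl_self T fals), fun h => absurd id h⟩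
  | bot => exact ⟨False.elim, fun _ => Deriv.impl_self T fals⟩
  | conj A B ihA ihB =>
    have ihA := ihA (fun a ha => hpos a (.inl ha)) (fun a ha => hneg a (.inl ha))
    have ihB := ihB (fun a ha => hpos a (.inr ha)) (fun a ha => hneg a (.inr ha))
    refine ⟨fun h => ?_, fun h => ?_⟩
    · have hA := ihA.1 h.1
      have hB := ihB.1 h.2
      refine Deriv.deduction (.mp (hA.mono (Set.subset_insert _ _)) ?_)
      refine Deriv.deduction (.mp (hB.mono ?_) ?_)
      · exact (Set.subset_insert _ _).trans (Set.subset_insert _ _)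
      refine Deriv.deduction (.mp (.ax (.inr (.inr (.inl rfl)))) ?_)
      exact Deriv.conj_iff.2 ⟨.ax (.inr (.inl rfl)), .ax (.inl rfl)⟩
    · by_cases hA : sat2 M A.toProp
      · exact Deriv.impl_trans (.conjElimR _ _) (ihB.2 fun hB => h ⟨hA, hB⟩)
      · exact Deriv.impl_trans (.conjElimL _ _) (ihA.2 hA)
  | disj A B ihA ihB =>
    have ihA := ihA (fun a ha => hpos a (.inl ha)) (fun a ha => hneg a (.inl ha))
    have ihB := ihB (fun a ha => hpos a (.inr ha)) (fun a ha => hneg a (.inr ha))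
    refine ⟨fun h => ?_, fun h => ?_⟩
    · rcases h with h | h
      · exact dnimap (.disjIntroL _ _) (ihA.1 h)
      · exact dnimap (.disjIntroR _ _) (ihB.1 h)
    · exact .mp (.mp (.disjElim _ _ _) (ihA.2 fun hA => h (.inl hA)))
        (ihB.2 fun hB => h (.inr hB))
  | neg A ih =>
    have ih := ih hpos hneg
    exact ⟨fun h => dni (ih.2 h), fun h => ih.1 (not_not.1 h)⟩

/-- In a consistent prime theory that decides every atom of `F` according to `M`, derivability of
`F` is satisfaction of the reduct by the derivable atoms of `M`. -/
theorem NF.deriv_iff_satB_reduct {S : Set (PropForm α)} (hcons : ¬ Deriv S fals)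
    (hprime : ∀ B C, Deriv S (PropForm.disj B C) → Deriv S B ∨ Deriv S C) {F : NF α}
    (hpos : ∀ a ∈ F.atoms, a ∈ M → Deriv S (PropForm.neg (PropForm.neg (.var a))))
    (hneg : ∀ a ∈ F.atoms, a ∉ M → Deriv S (PropForm.neg (.var a))) :
    Deriv S F.toProp ↔ (F.reduct M).satB {a ∈ M | Deriv S (PropForm.var a)} := by
  induction F with
  | var a =>
    refine ⟨fun h => ⟨?_, h⟩, fun h => h.2⟩
    by_contra ha
    exact hcons (.mp (hneg a rfl ha) h)
  | top => exact ⟨fun _ => trivial, fun _ => Deriv.impl_self S fals⟩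
  | bot => exact ⟨hcons, False.elim⟩
  | conj A B ihA ihB =>
    exact Deriv.conj_iff.trans (and_congr
      (ihA (fun a ha => hpos a (.inl ha)) (fun a ha => hneg a (.inl ha)))
      (ihB (fun a ha => hpos a (.inr ha)) (fun a ha => hneg a (.inr ha))))
  | disj A B ihA ihB =>
    refine Iff.trans ⟨hprime _ _, fun h => ?_⟩ (or_congr
      (ihA (fun a ha => hpos a (.inl ha)) (fun a ha => hneg a (.inl ha)))
      (ihB (fun a ha => hpos a (.inr ha)) (fun a ha => hneg a (.inr ha))))
    exact h.elim (.mp (.disjIntroL _ _)) (.mp (.disjIntroR _ _))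
  | neg A =>
    have hdec := NF.deriv_of_decides (F := A) hpos hneg
    by_cases hA : sat2 M A.toProp
    · have : ¬ Deriv S (PropForm.neg A.toProp) := fun h => hcons (.mp (hdec.1 hA) h)
      simpa [NF.reduct, NF.satB, NF.toProp, satB_reduct_self, hA] using this
    · simpa [NF.reduct, NF.satB, NF.toProp, satB_reduct_self, hA] using hdec.2 hA

end Semantics

/-- `M` is an answer set of the augmented program `P` iff
`P ∪ ¬M̃ ∪ ¬¬M ⊩_I M`. -/
theorem answerSet_iff_intuitionistic {α : Type} (P : List (AugClause α)) (M : Set α)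
    (hM : M ⊆ progSig P) :
    isAnswerSet P M ↔
      IProvesAll (progTh P ∪ negSet (progSig P \ M) ∪ negnegSet M) M := by
  set T := progTh P ∪ negSet (progSig P \ M) ∪ negnegSet M
  have hpos : ∀ a ∈ M, Deriv T (neg (neg (var a))) :=
    fun a ha => .ax (.inr ⟨a, ha, rfl⟩)
  have hneg : ∀ a ∈ progSig P, a ∉ M → Deriv T (neg (var a)) :=
    fun a ha haM => .ax (.inl (.inr ⟨a, ⟨ha, haM⟩, rfl⟩))
  have hmodel : ∀ N ⊆ M, closedUnder M (progReduct M P) → closedUnder N (progReduct M P) →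
      ∀ G ∈ T, satHT N M G := by
    intro N hN hcM hcN G hG
    rw [closedUnder_progReduct] at hcM hcN
    rcases hG with (⟨c, hc, rfl⟩ | ⟨a, ha, rfl⟩) | ⟨a, ha, rfl⟩
    · have h₁ := hcN c hc
      have h₂ := hcM c hc
      rw [NF.satB_reduct hN, NF.satB_reduct hN] at h₁
      rw [NF.satB_reduct_self, NF.satB_reduct_self] at h₂
      exact ⟨h₁, h₂⟩
    · exact ⟨fun h => ha.2 (hN h), ha.2⟩
    · exact ⟨fun h => h.2 ha, fun h => h ha⟩
  simp only [IProvesAll, IConsistent, iProves_iff_deriv]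
  constructor
  · rintro ⟨hcM, hmin⟩
    have hcons : ¬ Deriv T fals := Deriv.satHT subset_rfl (hmodel M subset_rfl hcM hcM)
    refine ⟨hcons, fun a ha => by_contra fun hTa => ?_⟩
    obtain ⟨S, hTS, hSa, hprime⟩ := Deriv.exists_prime_extension hTa
    have hScons : ¬ Deriv S fals := fun h => hSa (.mp (.falsElim _) h)
    have key : ∀ F : NF α, F.atoms ⊆ progSig P → (Deriv S F.toProp ↔
        (F.reduct M).satB {b ∈ M | Deriv S (var b)}) := fun F hF =>
      NF.deriv_iff_satB_reduct hScons hprime (fun b _ hb => (hpos b hb).mono hTS)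
        (fun b hbF hb => (hneg b (hF hbF) hb).mono hTS)
    have hN : {b ∈ M | Deriv S (var b)} = M := by
      refine hmin _ (Set.sep_subset _ _) (closedUnder_progReduct.2 fun c hc => ?_)
      rw [← key c.1 fun b hb => ⟨c, hc, .inl hb⟩, ← key c.2 fun b hb => ⟨c, hc, .inr hb⟩]
      exact .mp (.ax (hTS (.inl (.inl ⟨c, hc, rfl⟩))))
    rw [← hN] at ha
    exact hSa ha.2
  · rintro ⟨hcons, hprov⟩
    have hdec : ∀ F : NF α, F.atoms ⊆ progSig P → _ := fun F hF =>
      NF.deriv_of_decides (F := F) (fun a _ ha => hpos a ha)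
        (fun a haF ha => hneg a (hF haF) ha)
    have hcM : closedUnder M (progReduct M P) := by
      refine closedUnder_progReduct.2 fun c hc hB => by_contra fun hH => hcons ?_
      rw [NF.satB_reduct_self] at hB hH
      refine .mp ((hdec c.2 fun b hb => ⟨c, hc, .inr hb⟩).1 hB) ?_
      exact Deriv.impl_trans (.ax (.inl (.inl ⟨c, hc, rfl⟩)))
        ((hdec c.1 fun b hb => ⟨c, hc, .inl hb⟩).2 hH)
    refine ⟨hcM, fun N hN hcN => hN.antisymm fun a ha => ?_⟩
    exact Deriv.satHT hN (hmodel N hN hcM hcN) (hprov a ha)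

end ASP
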